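/- Let G be a simple graph with vertex set V, let k ≥ 2, and let {S_1, ..., S_k} be a partition of V into k nonempty parts. For each i define the vector s^(i) indexed by V with entry −k+1 at vertices of S_i and entry 1 at all other vertices. Then s^(i) is an eigenvector of the Laplacian L(G) = D(G) − A(G) to the eigenvalue μ for every i ∈ {1,...,k} if and only if for every pair i ≠ j the bipartite subgraph induced by the edges between S_i and S_j is (μ/k)-regular, i.e., d_v(S_i,S_j) = μ/k for every i, every j ≠ i, and every vertex v ∈ S_i. -/

import Mathlib

open Finset

/-- Number of neighbors of `v` (in graph `G`) lying in the set `X`. -/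
def degIn {n : ℕ} (G : SimpleGraph (Fin n)) [DecidableRel G.Adj]
    (v : Fin n) (X : Finset (Fin n)) : ℕ :=
  (X.filter fun u => G.Adj v u).card

/-- The Laplacian matrix `L(G) = D(G) - A(G)`. -/
def lap {n : ℕ} (G : SimpleGraph (Fin n)) [DecidableRel G.Adj] :
    Matrix (Fin n) (Fin n) ℝ :=
  Matrix.diagonal (fun v => (G.degree v : ℝ)) - G.adjMatrix ℝ

theorem degIn_eq_sum {n : ℕ} (G : SimpleGraph (Fin n)) [DecidableRel G.Adj]
    (v : Fin n) (X : Finset (Fin n)) :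
    (degIn G v X : ℝ) = ∑ u ∈ G.neighborFinset v, if u ∈ X then 1 else 0 := by
  rw [degIn, Finset.sum_boole]
  congr 2
  ext u
  simp [and_comm]

/-- The degree of a vertex is the sum of its degrees into the parts of a partition. -/
theorem sum_degIn_eq_degree {n k : ℕ} (G : SimpleGraph (Fin n)) [DecidableRel G.Adj]
    (S : Fin k → Finset (Fin n)) (hdisj : ∀ i j, i ≠ j → Disjoint (S i) (S j))
    (hcover : ∀ v, ∃ i, v ∈ S i) (v : Fin n) :
    ∑ i, (degIn G v (S i) : ℝ) = G.degree v := by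
  have hone (u : Fin n) : ∑ i, (if u ∈ S i then (1 : ℝ) else 0) = 1 := by
    obtain ⟨i, hi⟩ := hcover u
    rw [Finset.sum_eq_single i, if_pos hi]
    · exact fun j _ hji => if_neg (Finset.disjoint_right.mp (hdisj j i hji) hi)
    · simp
  simp_rw [degIn_eq_sum]
  rw [Finset.sum_comm]
  simp [hone]

/-- The Laplacian applied to `1 - k • 1_X`. -/
theorem lap_mulVec_apply_of_eq_ite {n : ℕ} (G : SimpleGraph (Fin n)) [DecidableRel G.Adj]
    (X : Finset (Fin n)) (k : ℝ) (s : Fin n → ℝ)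
    (hs : ∀ v, s v = if v ∈ X then -k + 1 else 1) (v : Fin n) :
    (lap G).mulVec s v = G.degree v * (s v - 1) + k * degIn G v X := by
  have hs' (u : Fin n) : s u = 1 - k * if u ∈ X then 1 else 0 := by
    rw [hs]
    split_ifs <;> ring
  have hsum : ∑ u ∈ G.neighborFinset v, s u = G.degree v - k * degIn G v X := by
    simp_rw [hs', Finset.sum_sub_distrib, ← Finset.mul_sum, ← degIn_eq_sum]
    simp
  rw [lap, Matrix.sub_mulVec, Pi.sub_apply, Matrix.mulVec_diagonal,
    SimpleGraph.adjMatrix_mulVec_apply, hsum]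
  ring

theorem stmt_14 {n k : ℕ} (hk : 2 ≤ k) (G : SimpleGraph (Fin n)) [DecidableRel G.Adj]
    (S : Fin k → Finset (Fin n))
    (hdisj : ∀ i j, i ≠ j → Disjoint (S i) (S j))
    (hcover : ∀ v, ∃ i, v ∈ S i)
    (hne : ∀ i, (S i).Nonempty)
    (s : Fin k → Fin n → ℝ)
    (hs : ∀ i v, s i v = if v ∈ S i then -(k : ℝ) + 1 else 1)
    (mu : ℝ) :
    (∀ i, s i ≠ 0 ∧ (lap G).mulVec (s i) = mu • s i) ↔
      (∀ i, ∀ j, j ≠ i → ∀ v ∈ S i, (degIn G v (S j) : ℝ) = mu / k) := by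
  have hk0 : (k : ℝ) ≠ 0 := by positivity
  have hlap (i : Fin k) (v : Fin n) :=
    lap_mulVec_apply_of_eq_ite G (S i) k (s i) (hs i) v
  constructor
  · intro h i j hji v hv
    have hvj : v ∉ S j := Finset.disjoint_right.mp (hdisj j i hji) hv
    have heq := congrFun (h j).2 v
    rw [hlap, Pi.smul_apply, hs, if_neg hvj, smul_eq_mul] at heq
    rw [eq_div_iff hk0]
    linarith
  · intro h i
    refine ⟨fun hzero => ?_, funext fun v => ?_⟩
    · obtain ⟨v, hv⟩ := hne i
      have heq := congrFun hzero v
      rw [hs, if_pos hv, Pi.zero_apply] at heq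
      have hk' : (2 : ℝ) ≤ k := by exact_mod_cast hk
      linarith
    · rw [hlap, Pi.smul_apply, hs, smul_eq_mul]
      by_cases hv : v ∈ S i
      · have hdeg := sum_degIn_eq_degree G S hdisj hcover v
        have hrest : ∑ j ∈ Finset.univ.erase i, (degIn G v (S j) : ℝ) = (k - 1) * (mu / k) := by
          rw [Finset.sum_congr rfl fun j hj => h i j (Finset.ne_of_mem_erase hj) v hv]
          rw [Finset.sum_const, Finset.card_erase_of_mem (Finset.mem_univ i), Finset.card_univ,
            Fintype.card_fin, nsmul_eq_mul, Nat.cast_sub (by omega), Nat.cast_one]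
        rw [← Finset.add_sum_erase _ _ (Finset.mem_univ i), hrest] at hdeg
        rw [if_pos hv, ← hdeg]
        field_simp
        ring
      · obtain ⟨j, hj⟩ := hcover v
        have hij : i ≠ j := by
          rintro rfl
          exact hv hj
        rw [if_neg hv, h j i hij v hj]
        field_simp
        ring
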